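/- For all x, c ∈ X and y ∈ X_d, the directional derivative of the potential functional at x in direction y exists and equals d_x U(x; c)[y] = L'(1)·H([x − c ⊛ λ^⊛(ρ^⊠(x))] ⊛ [ρ'^⊠(x) ⊠ y]), where ρ'^⊠(x) = Σ_n n·ρ_n·x^{⊠(n−1)}. -/

import Mathlib

open MeasureTheory Real Filter Topology Polynomial

noncomputable section

/-- The space of finite signed Borel measures on the extended reals `ℝ̄`. -/
abbrev SM := MeasureTheory.SignedMeasure EReal

namespace SCLDPC

/-- The weight `e^{-α/2}` as an extended nonnegative real (`+∞` at `α = -∞`). -/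
def wt (α : EReal) : ENNReal :=
  if α = ⊥ then ⊤ else if α = ⊤ then 0 else ENNReal.ofReal (Real.exp (-(α.toReal) / 2))

/-- A (nonnegative) Borel measure `μ` on `ℝ̄` is symmetric if
`∫_{-E} e^{-α/2} μ(dα) = ∫_{E} e^{-α/2} μ(dα)` for every Borel set `E`
(stated with extended nonnegative integrals, which is equivalent to requiring
equality whenever one of the two sides is finite). -/
def IsSymmMeasure (μ : Measure EReal) : Prop :=
  ∀ E : Set EReal, MeasurableSet E →
    ∫⁻ α in (fun a : EReal => -a) ⁻¹' E, wt α ∂μ = ∫⁻ α in E, wt α ∂μ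

/-- Positive part of the Jordan decomposition. -/
def jp (x : SM) : Measure EReal := x.toJordanDecomposition.posPart

/-- Negative part of the Jordan decomposition. -/
def jn (x : SM) : Measure EReal := x.toJordanDecomposition.negPart

instance (x : SM) : IsFiniteMeasure (jp x) := x.toJordanDecomposition.posPart_finite

instance (x : SM) : IsFiniteMeasure (jn x) := x.toJordanDecomposition.negPart_finite

/-- A finite signed Borel measure on `ℝ̄` is symmetric iff both parts of its Jordan
decomposition are symmetric measures. -/
def IsSymm (x : SM) : Prop := IsSymmMeasure (jp x) ∧ IsSymmMeasure (jn x)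

/-- Membership in `X`, the set of symmetric probability measures on `ℝ̄`. -/
def MemX (x : SM) : Prop :=
  (∃ (μ : Measure EReal) (hμ : IsProbabilityMeasure μ),
      x = (letI := hμ; μ.toSignedMeasure)) ∧ IsSymm x

/-- Membership in `X_d`, the set of differences of symmetric probability measures. -/
def MemXd (y : SM) : Prop := ∃ x1 x2 : SM, MemX x1 ∧ MemX x2 ∧ y = x1 - x2

/-- Integral of a real function against a finite signed measure. -/
def sInt (f : EReal → ℝ) (x : SM) : ℝ := (∫ α, f α ∂(jp x)) - ∫ α, f α ∂(jn x)

/-- `tanh(α/2)` extended continuously to `ℝ̄`. -/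
def tanhHalf (α : EReal) : ℝ :=
  if α = ⊤ then 1 else if α = ⊥ then -1 else Real.tanh (α.toReal / 2)

/-- The inverse hyperbolic tangent on `(-1, 1)`. -/
def artanh (t : ℝ) : ℝ := Real.log ((1 + t) / (1 - t)) / 2

/-- `2 tanh⁻¹(t)` valued in `ℝ̄` (sending `t ≥ 1` to `+∞` and `t ≤ -1` to `-∞`). -/
def atanhTwo (t : ℝ) : EReal :=
  if 1 ≤ t then ⊤ else if t ≤ -1 then ⊥ else ((2 * artanh t : ℝ) : EReal)

/-- Variable-node convolution `⊛` of two (nonnegative) measures: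
`(μ ⊛ ν)(E) = ∫ μ(E - α) ν(dα)`, i.e. the pushforward of `μ × ν` under addition. -/
def mConv (μ ν : Measure EReal) : Measure EReal :=
  (μ.prod ν).map fun p => p.1 + p.2

/-- Check-node convolution `⊠` of two (nonnegative) measures:
`(μ ⊠ ν)(E) = ∫ μ(2 tanh⁻¹(tanh(E/2) / tanh(α/2))) ν(dα)`, where the argument of `μ`
is the image of `E` under `β ↦ 2 tanh⁻¹(tanh(β/2) / tanh(α/2))`; equivalently, the
pushforward of `μ × ν` under `(β, α) ↦ 2 tanh⁻¹(tanh(β/2) · tanh(α/2))`. -/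
def mCheck (μ ν : Measure EReal) : Measure EReal :=
  (μ.prod ν).map fun p => atanhTwo (tanhHalf p.1 * tanhHalf p.2)

instance (μ ν : Measure EReal) [IsFiniteMeasure μ] [IsFiniteMeasure ν] :
    IsFiniteMeasure (mConv μ ν) := by unfold mConv; infer_instance

instance (μ ν : Measure EReal) [IsFiniteMeasure μ] [IsFiniteMeasure ν] :
    IsFiniteMeasure (mCheck μ ν) := by unfold mCheck; infer_instance

/-- The variable-node operation `⊛` extended bilinearly to finite signed measures. -/
def sConv (x y : SM) : SM :=
  (mConv (jp x) (jp y)).toSignedMeasure - (mConv (jp x) (jn y)).toSignedMeasure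
    - (mConv (jn x) (jp y)).toSignedMeasure + (mConv (jn x) (jn y)).toSignedMeasure

/-- The check-node operation `⊠` extended bilinearly to finite signed measures. -/
def sCheck (x y : SM) : SM :=
  (mCheck (jp x) (jp y)).toSignedMeasure - (mCheck (jp x) (jn y)).toSignedMeasure
    - (mCheck (jn x) (jp y)).toSignedMeasure + (mCheck (jn x) (jn y)).toSignedMeasure

/-- The integrand `log₂(1 + e^{-α})` of the entropy functional (with the harmless
convention that it vanishes at `α = ±∞`; symmetric measures put no mass at `-∞`). -/
def entFn (α : EReal) : ℝ :=
  if α = ⊤ then 0 else if α = ⊥ then 0 else Real.logb 2 (1 + Real.exp (-(α.toReal)))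

/-- The entropy functional `H(x) = ∫ log₂(1 + e^{-α}) x(dα)`. -/
def H (x : SM) : ℝ := sInt entFn x

/-- `Δ_0`, the unit point mass at `0`. -/
def d0 : SM := (Measure.dirac (0 : EReal)).toSignedMeasure

/-- `Δ_∞`, the unit point mass at `+∞`. -/
def dTop : SM := (Measure.dirac (⊤ : EReal)).toSignedMeasure

/-- `x^{⊛n}` with `x^{⊛0} = Δ_0`. -/
def convPow (x : SM) : ℕ → SM
  | 0 => d0
  | n + 1 => sConv (convPow x n) x

/-- `x^{⊠n}` with `x^{⊠0} = Δ_∞`. -/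
def checkPow (x : SM) : ℕ → SM
  | 0 => dTop
  | n + 1 => sCheck (checkPow x n) x

/-- `p^{⊛}(x) = Σ_n p_n x^{⊛n}` for a real polynomial `p`. -/
def polyConv (p : Polynomial ℝ) (x : SM) : SM :=
  ∑ n ∈ Finset.range (p.natDegree + 1), p.coeff n • convPow x n

/-- `p^{⊠}(x) = Σ_n p_n x^{⊠n}` for a real polynomial `p`. -/
def polyCheck (p : Polynomial ℝ) (x : SM) : SM :=
  ∑ n ∈ Finset.range (p.natDegree + 1), p.coeff n • checkPow x n

/-- The single-system potential functional `U(x; c)` of the LDPC(λ, ρ) ensemble: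
`U(x; c) = (L'(1)/R'(1)) H(R^⊠(x)) + L'(1) H(ρ^⊠(x)) - L'(1) H(x ⊠ ρ^⊠(x))
  - H(c ⊛ L^⊛(ρ^⊠(x)))`. -/
def potU (rho L R : Polynomial ℝ) (x c : SM) : ℝ :=
  (derivative L).eval 1 / (derivative R).eval 1 * H (polyCheck R x)
    + (derivative L).eval 1 * H (polyCheck rho x)
    - (derivative L).eval 1 * H (sCheck x (polyCheck rho x))
    - H (sConv c (polyConv L (polyCheck rho x)))

/-! ### Pointwise facts about the kernels -/

lemma tanhHalf_coe (a : ℝ) :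
    tanhHalf (a : EReal) = (1 - Real.exp (-a)) / (1 + Real.exp (-a)) := by
  have h1 : tanhHalf (a : EReal) = Real.tanh (a / 2) := by
    simp [tanhHalf]
  rw [h1, Real.tanh_eq_sinh_div_cosh, Real.sinh_eq, Real.cosh_eq]
  have h2 : Real.exp (-a) = Real.exp (-(a / 2)) * Real.exp (-(a / 2)) := by
    rw [← Real.exp_add]; congr 1; ring
  have h3 : Real.exp (a / 2) * Real.exp (-(a / 2)) = 1 := by
    rw [← Real.exp_add]; simp
  have p1 := Real.exp_pos (a / 2)
  have p2 := Real.exp_pos (-(a / 2))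
  rw [h2]
  rw [div_div_div_cancel_right₀ (by norm_num), div_eq_div_iff (by positivity) (by positivity)]
  linear_combination (2 * Real.exp (-(a / 2))) * h3

lemma tanhHalf_top : tanhHalf ⊤ = 1 := by simp [tanhHalf]

lemma tanhHalf_bot : tanhHalf ⊥ = -1 := by simp [tanhHalf]

lemma tanhHalf_coe_lt (a : ℝ) : -1 < tanhHalf (a : EReal) ∧ tanhHalf (a : EReal) < 1 := by
  have p := Real.exp_pos (-a)
  rw [tanhHalf_coe, lt_div_iff₀ (by positivity), div_lt_iff₀ (by positivity)]
  constructor <;> linarith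

lemma tanhHalf_mem (a : EReal) : -1 ≤ tanhHalf a ∧ tanhHalf a ≤ 1 := by
  induction a with
  | bot => simp [tanhHalf_bot]
  | top => simp [tanhHalf_top]
  | coe a => exact ⟨(tanhHalf_coe_lt a).1.le, (tanhHalf_coe_lt a).2.le⟩

lemma tanhHalf_gt {a : EReal} (h : a ≠ ⊥) : -1 < tanhHalf a := by
  induction a with
  | bot => simp at h
  | top => simp [tanhHalf_top]
  | coe a => exact (tanhHalf_coe_lt a).1

lemma mul_mem {s t : ℝ} (hs : -1 ≤ s ∧ s ≤ 1) (ht : -1 ≤ t ∧ t ≤ 1) :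
    -1 ≤ s * t ∧ s * t ≤ 1 := by
  constructor <;> nlinarith

lemma exp_artanh {t : ℝ} (h1 : -1 < t) (h2 : t < 1) :
    Real.exp (-(2 * artanh t)) = (1 - t) / (1 + t) := by
  have : 2 * artanh t = Real.log ((1 + t) / (1 - t)) := by unfold artanh; ring
  rw [this, ← Real.log_inv, Real.exp_log, inv_div]
  rw [inv_div]
  exact div_pos (by linarith) (by linarith)

lemma tanhHalf_atanhTwo {t : ℝ} (h : -1 ≤ t ∧ t ≤ 1) : tanhHalf (atanhTwo t) = t := by
  unfold atanhTwo
  split_ifs with h1 h2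
  · rw [tanhHalf_top]; linarith
  · rw [tanhHalf_bot]; linarith
  · push Not at h1 h2
    rw [tanhHalf_coe, exp_artanh h2 h1]
    have : 1 + t ≠ 0 := by linarith
    field_simp
    ring

/-- The check-node kernel. -/
def ck (p : EReal × EReal) : EReal := atanhTwo (tanhHalf p.1 * tanhHalf p.2)

/-- The variable-node kernel. -/
def vk (p : EReal × EReal) : EReal := p.1 + p.2

lemma tanhHalf_ck (a b : EReal) : tanhHalf (ck (a, b)) = tanhHalf a * tanhHalf b :=
  tanhHalf_atanhTwo (mul_mem (tanhHalf_mem a) (tanhHalf_mem b))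

lemma ck_assoc (a b c : EReal) : ck (ck (a, b), c) = ck (a, ck (b, c)) := by
  have h1 : ck (ck (a, b), c) = atanhTwo (tanhHalf (ck (a, b)) * tanhHalf c) := rfl
  have h2 : ck (a, ck (b, c)) = atanhTwo (tanhHalf a * tanhHalf (ck (b, c))) := rfl
  rw [h1, h2, tanhHalf_ck, tanhHalf_ck, mul_assoc]

lemma ck_comm (a b : EReal) : ck (a, b) = ck (b, a) := by
  simp [ck, mul_comm]

lemma vk_assoc (a b c : EReal) : vk (vk (a, b), c) = vk (a, vk (b, c)) := add_assoc a b c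

lemma vk_comm (a b : EReal) : vk (a, b) = vk (b, a) := add_comm a b

lemma ck_ne_bot {a b : EReal} (ha : a ≠ ⊥) (hb : b ≠ ⊥) : ck (a, b) ≠ ⊥ := by
  intro h
  have h1 := tanhHalf_ck a b
  rw [h, tanhHalf_bot] at h1
  have := tanhHalf_gt ha
  have := tanhHalf_gt hb
  have := (tanhHalf_mem a).2
  have := (tanhHalf_mem b).2
  nlinarith

lemma vk_ne_bot {a b : EReal} (ha : a ≠ ⊥) (hb : b ≠ ⊥) : vk (a, b) ≠ ⊥ := by
  simp [vk, EReal.add_eq_bot_iff, ha, hb]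

lemma entFn_coe (a : ℝ) : entFn (a : EReal) = Real.logb 2 (1 + Real.exp (-a)) := by
  simp [entFn]

lemma entFn_nonneg (a : EReal) : 0 ≤ entFn a := by
  unfold entFn
  split_ifs
  · rfl
  · rfl
  · apply Real.logb_nonneg (by norm_num)
    have := Real.exp_pos (-a.toReal)
    linarith

lemma ck_top_left (b : EReal) : entFn (ck (⊤, b)) = entFn b := by
  have : ck (⊤, b) = b := by
    unfold ck
    simp only [tanhHalf_top, one_mul]
    induction b with
    | bot => simp [tanhHalf_bot, atanhTwo]
    | top => simp [tanhHalf_top, atanhTwo]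
    | coe b =>
      have h := tanhHalf_coe_lt b
      unfold atanhTwo
      rw [if_neg (by linarith [h.2]), if_neg (by linarith [h.1])]
      congr 1
      have h2 := exp_artanh h.1 h.2
      have : Real.exp (-(2 * artanh (tanhHalf (b : EReal)))) = Real.exp (-b) := by
        rw [h2, tanhHalf_coe]
        have := Real.exp_pos (-b)
        field_simp
        ring
      have := Real.exp_injective this
      linarith
  rw [this]

/-- Pointwise duality. -/
lemma duality_pt {a b : EReal} (ha : a ≠ ⊥) (hb : b ≠ ⊥) :
    entFn (vk (a, b)) + entFn (ck (a, b)) = entFn a + entFn b := by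
  have hT : entFn ⊤ = 0 := by simp [entFn]
  induction a with
  | bot => simp at ha
  | top =>
    rw [ck_top_left, vk]
    simp [EReal.top_add_of_ne_bot hb]
  | coe a =>
    induction b with
    | bot => simp at hb
    | top =>
      rw [ck_comm, ck_top_left, vk]
      simp [hT]
    | coe b =>
      have hta := tanhHalf_coe_lt a
      have htb := tanhHalf_coe_lt b
      set t := tanhHalf (a : EReal) * tanhHalf (b : EReal) with ht
      have h1 : -1 < t := by rw [ht]; nlinarith
      have h2 : t < 1 := by rw [ht]; nlinarith
      have hv : vk ((a : EReal), (b : EReal)) = ((a + b : ℝ) : EReal) := by simp [vk]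
      have hc : ck ((a : EReal), (b : EReal)) = ((2 * artanh t : ℝ) : EReal) := by
        show atanhTwo t = _
        unfold atanhTwo
        rw [if_neg (by linarith), if_neg (by linarith)]
      rw [hv, hc, entFn_coe, entFn_coe, entFn_coe, entFn_coe, exp_artanh h1 h2]
      have pa := Real.exp_pos (-a)
      have pb := Real.exp_pos (-b)
      have hab : Real.exp (-(a + b)) = Real.exp (-a) * Real.exp (-b) := by
        rw [← Real.exp_add]; congr 1; ring
      have h1t : 1 + t ≠ 0 := by linarith
      have p3 : 0 < 1 + (1 - t) / (1 + t) := by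
        have : 0 < (1 - t) / (1 + t) := div_pos (by linarith) (by linarith)
        linarith
      rw [← Real.logb_mul (by positivity) p3.ne', ← Real.logb_mul (by positivity) (by positivity)]
      congr 1
      have e1 : 1 + (1 - t) / (1 + t) = 2 / (1 + t) := by field_simp; ring
      rw [e1, mul_div_assoc', div_eq_iff h1t, ht, tanhHalf_coe, tanhHalf_coe, hab]
      field_simp
      ring

lemma measurable_tanhHalf : Measurable tanhHalf := by
  apply EReal.measurable_of_measurable_real
  simp_rw [tanhHalf_coe]
  fun_prop

lemma measurable_atanhTwo : Measurable atanhTwo := by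
  unfold atanhTwo artanh
  refine Measurable.ite measurableSet_Ici measurable_const
    (Measurable.ite measurableSet_Iic measurable_const ?_)
  apply Measurable.coe_real_ereal
  fun_prop

lemma measurable_ck : Measurable ck :=
  measurable_atanhTwo.comp ((measurable_tanhHalf.comp measurable_fst).mul
    (measurable_tanhHalf.comp measurable_snd))

lemma measurable_vk : Measurable vk := measurable_fst.add measurable_snd

lemma measurable_entFn : Measurable entFn := by
  apply EReal.measurable_of_measurable_real
  simp_rw [entFn_coe, Real.logb]
  fun_prop

lemma measurable_wt : Measurable wt := by
  apply EReal.measurable_of_measurable_real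
  have : (fun p : ℝ => wt (p : EReal)) = fun p => ENNReal.ofReal (Real.exp (-p / 2)) := by
    funext p; simp [wt]
  rw [this]
  fun_prop

/-! ### Generic bilinear operations on signed measures -/

/-- Push-forward of a product measure under a kernel. -/
def mG (φ : EReal × EReal → EReal) (μ ν : Measure EReal) : Measure EReal := (μ.prod ν).map φ

instance (φ : EReal × EReal → EReal) (μ ν : Measure EReal) [IsFiniteMeasure μ]
    [IsFiniteMeasure ν] : IsFiniteMeasure (mG φ μ ν) := by unfold mG; infer_instance

/-- The bilinear extension of `mG` to signed measures. -/
def sG (φ : EReal × EReal → EReal) (x y : SM) : SM :=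
  (mG φ (jp x) (jp y)).toSignedMeasure - (mG φ (jp x) (jn y)).toSignedMeasure
    - (mG φ (jn x) (jp y)).toSignedMeasure + (mG φ (jn x) (jn y)).toSignedMeasure

lemma sConv_eq (x y : SM) : sConv x y = sG vk x y := rfl

lemma sCheck_eq (x y : SM) : sCheck x y = sG ck x y := rfl

lemma jordan_eq (x : SM) : x = (jp x).toSignedMeasure - (jn x).toSignedMeasure :=
  (SignedMeasure.toSignedMeasure_toJordanDecomposition x).symm

lemma mG_add_left {φ : EReal × EReal → EReal} (hφ : Measurable φ) (μ μ' ν : Measure EReal)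
    [IsFiniteMeasure μ] [IsFiniteMeasure μ'] [IsFiniteMeasure ν] :
    (mG φ (μ + μ') ν).toSignedMeasure
      = (mG φ μ ν).toSignedMeasure + (mG φ μ' ν).toSignedMeasure := by
  rw [← Measure.toSignedMeasure_add]
  apply Measure.toSignedMeasure_congr
  simp only [mG]
  rw [Measure.add_prod, Measure.map_add _ _ hφ]

lemma mG_add_right {φ : EReal × EReal → EReal} (hφ : Measurable φ) (μ ν ν' : Measure EReal)
    [IsFiniteMeasure μ] [IsFiniteMeasure ν] [IsFiniteMeasure ν'] :
    (mG φ μ (ν + ν')).toSignedMeasure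
      = (mG φ μ ν).toSignedMeasure + (mG φ μ ν').toSignedMeasure := by
  rw [← Measure.toSignedMeasure_add]
  apply Measure.toSignedMeasure_congr
  simp only [mG]
  rw [Measure.prod_add, Measure.map_add _ _ hφ]

lemma measure_eq_of_sub_eq {x : SM} {μ ν : Measure EReal} [IsFiniteMeasure μ]
    [IsFiniteMeasure ν] (h : x = μ.toSignedMeasure - ν.toSignedMeasure) :
    jp x + ν = μ + jn x := by
  apply Measure.toSignedMeasure_eq_toSignedMeasure_iff.1
  rw [Measure.toSignedMeasure_add, Measure.toSignedMeasure_add]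
  have h2 := (jordan_eq x).symm.trans h
  rw [sub_eq_sub_iff_add_eq_add] at h2
  exact h2

lemma sG_eq {φ : EReal × EReal → EReal} (hφ : Measurable φ) {x y : SM}
    {μ ν μ' ν' : Measure EReal} [IsFiniteMeasure μ] [IsFiniteMeasure ν] [IsFiniteMeasure μ']
    [IsFiniteMeasure ν'] (hx : x = μ.toSignedMeasure - ν.toSignedMeasure)
    (hy : y = μ'.toSignedMeasure - ν'.toSignedMeasure) :
    sG φ x y = (mG φ μ μ').toSignedMeasure - (mG φ μ ν').toSignedMeasure
      - (mG φ ν μ').toSignedMeasure + (mG φ ν ν').toSignedMeasure := by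
  have ex := measure_eq_of_sub_eq hx
  have ey := measure_eq_of_sub_eq hy
  have e1 : ∀ (Z : Measure EReal) [IsFiniteMeasure Z],
      (mG φ (jp x) Z).toSignedMeasure + (mG φ ν Z).toSignedMeasure
        = (mG φ μ Z).toSignedMeasure + (mG φ (jn x) Z).toSignedMeasure := by
    intro Z _
    rw [← mG_add_left hφ, ← mG_add_left hφ]
    exact Measure.toSignedMeasure_congr (by rw [ex])
  have e2 : ∀ (Z : Measure EReal) [IsFiniteMeasure Z],
      (mG φ Z (jp y)).toSignedMeasure + (mG φ Z ν').toSignedMeasure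
        = (mG φ Z μ').toSignedMeasure + (mG φ Z (jn y)).toSignedMeasure := by
    intro Z _
    rw [← mG_add_right hφ, ← mG_add_right hφ]
    exact Measure.toSignedMeasure_congr (by rw [ey])
  unfold sG
  linear_combination (norm := module) e1 (jp y) - e1 (jn y) + e2 μ - e2 ν

lemma sG_meas {φ : EReal × EReal → EReal} (hφ : Measurable φ) (μ ν : Measure EReal)
    [IsFiniteMeasure μ] [IsFiniteMeasure ν] :
    sG φ μ.toSignedMeasure ν.toSignedMeasure = (mG φ μ ν).toSignedMeasure := by
  have h := sG_eq hφ (x := μ.toSignedMeasure) (y := ν.toSignedMeasure) (μ := μ) (ν := 0) (μ' := ν)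
    (ν' := 0) (by simp) (by simp)
  rw [h]
  have z1 : (mG φ μ 0).toSignedMeasure = 0 := by
    rw [← Measure.toSignedMeasure_zero]
    exact Measure.toSignedMeasure_congr (by simp [mG])
  have z2 : (mG φ 0 ν).toSignedMeasure = 0 := by
    rw [← Measure.toSignedMeasure_zero]
    exact Measure.toSignedMeasure_congr (by simp [mG])
  have z3 : (mG φ 0 0).toSignedMeasure = 0 := by
    rw [← Measure.toSignedMeasure_zero]
    exact Measure.toSignedMeasure_congr (by simp [mG])
  rw [z1, z2, z3]; simp

lemma sG_comm {φ : EReal × EReal → EReal} (hφ : Measurable φ) (hc : ∀ a b, φ (a, b) = φ (b, a))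
    (x y : SM) : sG φ x y = sG φ y x := by
  have h : ∀ (μ ν : Measure EReal) [IsFiniteMeasure μ] [IsFiniteMeasure ν],
      (mG φ μ ν).toSignedMeasure = (mG φ ν μ).toSignedMeasure := by
    intro μ ν _ _
    apply Measure.toSignedMeasure_congr
    simp only [mG]
    rw [← Measure.prod_swap, Measure.map_map hφ measurable_swap]
    congr 1
    funext p
    exact hc _ _
  unfold sG
  rw [h (jp x) (jp y), h (jp x) (jn y), h (jn x) (jp y), h (jn x) (jn y)]
  abel

lemma sG_add_left {φ : EReal × EReal → EReal} (hφ : Measurable φ) (x x' y : SM) :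
    sG φ (x + x') y = sG φ x y + sG φ x' y := by
  have h : x + x' = (jp x + jp x').toSignedMeasure - (jn x + jn x').toSignedMeasure := by
    rw [Measure.toSignedMeasure_add, Measure.toSignedMeasure_add]
    nth_rewrite 1 [jordan_eq x, jordan_eq x']
    abel
  rw [sG_eq hφ h (jordan_eq y)]
  simp only [mG_add_left hφ]
  unfold sG
  abel

lemma sG_add_right {φ : EReal × EReal → EReal} (hφ : Measurable φ) (x y y' : SM) :
    sG φ x (y + y') = sG φ x y + sG φ x y' := by
  have h : y + y' = (jp y + jp y').toSignedMeasure - (jn y + jn y').toSignedMeasure := by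
    rw [Measure.toSignedMeasure_add, Measure.toSignedMeasure_add]
    nth_rewrite 1 [jordan_eq y, jordan_eq y']
    abel
  rw [sG_eq hφ (jordan_eq x) h]
  simp only [mG_add_right hφ]
  unfold sG
  abel

lemma mG_smul_left {φ : EReal × EReal → EReal} (μ ν : Measure EReal)
    [IsFiniteMeasure μ] [IsFiniteMeasure ν] (r : NNReal) :
    (mG φ (r • μ) ν).toSignedMeasure = (r : ℝ) • (mG φ μ ν).toSignedMeasure := by
  have h := Measure.toSignedMeasure_smul (mG φ μ ν) r
  rw [NNReal.smul_def] at h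
  rw [← h]
  apply Measure.toSignedMeasure_congr
  simp only [mG]
  rw [Measure.prod_smul_left, Measure.map_smul]

lemma mG_smul_right {φ : EReal × EReal → EReal} (μ ν : Measure EReal)
    [IsFiniteMeasure μ] [IsFiniteMeasure ν] (r : NNReal) :
    (mG φ μ (r • ν)).toSignedMeasure = (r : ℝ) • (mG φ μ ν).toSignedMeasure := by
  have h := Measure.toSignedMeasure_smul (mG φ μ ν) r
  rw [NNReal.smul_def] at h
  rw [← h]
  apply Measure.toSignedMeasure_congr
  simp only [mG]
  rw [Measure.prod_smul_right, Measure.map_smul]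

lemma nn_smul_eq (x : SM) (r : NNReal) :
    (r : ℝ) • x = (r • jp x).toSignedMeasure - (r • jn x).toSignedMeasure := by
  rw [Measure.toSignedMeasure_smul, Measure.toSignedMeasure_smul, NNReal.smul_def,
    NNReal.smul_def]
  nth_rewrite 1 [jordan_eq x]
  module

lemma sG_nn_left {φ : EReal × EReal → EReal} (hφ : Measurable φ) (x y : SM) (r : NNReal) :
    sG φ ((r : ℝ) • x) y = (r : ℝ) • sG φ x y := by
  rw [sG_eq hφ (nn_smul_eq x r) (jordan_eq y)]
  simp only [mG_smul_left]
  unfold sG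
  simp only [smul_sub, smul_add]

lemma sG_nn_right {φ : EReal × EReal → EReal} (hφ : Measurable φ) (x y : SM) (r : NNReal) :
    sG φ x ((r : ℝ) • y) = (r : ℝ) • sG φ x y := by
  rw [sG_eq hφ (jordan_eq x) (nn_smul_eq y r)]
  simp only [mG_smul_right]
  unfold sG
  simp only [smul_sub, smul_add]

/-- `sG` as a bilinear map. -/
def bG (φ : EReal × EReal → EReal) (hφ : Measurable φ) : SM →ₗ[ℝ] SM →ₗ[ℝ] SM :=
  LinearMap.mk₂ ℝ (sG φ) (sG_add_left hφ)
    (by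
      intro c x y
      have hc : c = (c.toNNReal : ℝ) - ((-c).toNNReal : ℝ) := by
        rw [Real.coe_toNNReal', Real.coe_toNNReal']
        simp
      have h : sG φ (c • x + ((-c).toNNReal : ℝ) • x) y = sG φ ((c.toNNReal : ℝ) • x) y := by
        congr 1
        nth_rewrite 1 [hc]
        module
      rw [sG_add_left hφ, sG_nn_left hφ, sG_nn_left hφ] at h
      nth_rewrite 2 [hc]
      linear_combination (norm := module) h)
    (sG_add_right hφ)
    (by
      intro c x y
      have hc : c = (c.toNNReal : ℝ) - ((-c).toNNReal : ℝ) := by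
        rw [Real.coe_toNNReal', Real.coe_toNNReal']
        simp
      have h : sG φ x (c • y + ((-c).toNNReal : ℝ) • y) = sG φ x ((c.toNNReal : ℝ) • y) := by
        congr 1
        nth_rewrite 1 [hc]
        module
      rw [sG_add_right hφ, sG_nn_right hφ, sG_nn_right hφ] at h
      nth_rewrite 2 [hc]
      linear_combination (norm := module) h)

lemma bG_apply (φ : EReal × EReal → EReal) (hφ : Measurable φ) (x y : SM) :
    bG φ hφ x y = sG φ x y := rfl

lemma bG_meas {φ : EReal × EReal → EReal} (hφ : Measurable φ) (μ ν : Measure EReal)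
    [IsFiniteMeasure μ] [IsFiniteMeasure ν] :
    bG φ hφ μ.toSignedMeasure ν.toSignedMeasure = (mG φ μ ν).toSignedMeasure := sG_meas hφ μ ν

lemma bG_comm {φ : EReal × EReal → EReal} (hφ : Measurable φ)
    (hc : ∀ a b, φ (a, b) = φ (b, a)) (x y : SM) : bG φ hφ x y = bG φ hφ y x :=
  sG_comm hφ hc x y

lemma mG_assoc {φ : EReal × EReal → EReal} (hφ : Measurable φ)
    (ha : ∀ a b c, φ (φ (a, b), c) = φ (a, φ (b, c))) (μ ν τ : Measure EReal)
    [IsFiniteMeasure μ] [IsFiniteMeasure ν] [IsFiniteMeasure τ] :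
    mG φ (mG φ μ ν) τ = mG φ μ (mG φ ν τ) := by
  unfold mG
  have h1 := Measure.map_prod_map (μ.prod ν) τ hφ measurable_id
  have h2 := Measure.map_prod_map μ (ν.prod τ) measurable_id hφ
  rw [Measure.map_id] at h1 h2
  rw [h1, h2, Measure.map_map hφ (by fun_prop), Measure.map_map hφ (by fun_prop),
    ← Measure.prodAssoc_prod, Measure.map_map (by fun_prop) (by fun_prop)]
  congr 1
  funext p
  exact ha _ _ _

lemma bG_assoc {φ : EReal × EReal → EReal} (hφ : Measurable φ)
    (ha : ∀ a b c, φ (φ (a, b), c) = φ (a, φ (b, c))) (x y z : SM) :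
    bG φ hφ (bG φ hφ x y) z = bG φ hφ x (bG φ hφ y z) := by
  have key : ∀ (μ ν τ : Measure EReal) [IsFiniteMeasure μ] [IsFiniteMeasure ν]
      [IsFiniteMeasure τ], (mG φ (mG φ μ ν) τ).toSignedMeasure
        = (mG φ μ (mG φ ν τ)).toSignedMeasure := fun μ ν τ _ _ _ =>
    Measure.toSignedMeasure_congr (mG_assoc hφ ha μ ν τ)
  rw [jordan_eq x, jordan_eq y, jordan_eq z]
  simp only [map_sub, LinearMap.sub_apply, bG_meas, key]

/-! ### The good class of measures -/

/-- No mass at `-∞` and finite entropy. -/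
def Good (μ : Measure EReal) : Prop :=
  IsFiniteMeasure μ ∧ (∀ᵐ a ∂μ, a ≠ ⊥) ∧ Integrable entFn μ

lemma Good.add {μ ν : Measure EReal} (h : Good μ) (h' : Good ν) : Good (μ + ν) := by
  obtain ⟨h1, h2, h3⟩ := h
  obtain ⟨h1', h2', h3'⟩ := h'
  refine ⟨inferInstance, ?_, h3.add_measure h3'⟩
  rw [ae_add_measure_iff]
  exact ⟨h2, h2'⟩

lemma Good.smul {μ : Measure EReal} (h : Good μ) (r : NNReal) : Good (r • μ) := by
  obtain ⟨h1, h2, h3⟩ := h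
  exact ⟨inferInstance, Measure.ae_smul_measure h2 r, h3.smul_measure_nnreal⟩

lemma ae_prod_ne {μ ν : Measure EReal} (h : Good μ) (h' : Good ν) :
    ∀ᵐ p ∂(μ.prod ν), p.1 ≠ ⊥ ∧ p.2 ≠ ⊥ := by
  obtain ⟨h1, h2, h3⟩ := h
  obtain ⟨h1', h2', h3'⟩ := h'
  filter_upwards [Measure.quasiMeasurePreserving_fst.ae h2,
    Measure.quasiMeasurePreserving_snd.ae h2'] with p hp hp'
  exact ⟨hp, hp'⟩

lemma int_prod {μ ν : Measure EReal} (h : Good μ) (h' : Good ν) :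
    Integrable (fun p : EReal × EReal => entFn p.1 + entFn p.2) (μ.prod ν) := by
  obtain ⟨h1, h2, h3⟩ := h
  obtain ⟨h1', h2', h3'⟩ := h'
  exact (h3.comp_fst ν).add (h3'.comp_snd μ)

lemma Good.mG {φ : EReal × EReal → EReal} (hφ : Measurable φ)
    (hb : ∀ a b, a ≠ ⊥ → b ≠ ⊥ → φ (a, b) ≠ ⊥)
    (hle : ∀ a b, a ≠ ⊥ → b ≠ ⊥ → entFn (φ (a, b)) ≤ entFn a + entFn b)
    {μ ν : Measure EReal} (h : Good μ) (h' : Good ν) : Good (mG φ μ ν) := by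
  have hae := ae_prod_ne h h'
  have hintg := int_prod h h'
  have f1 := h.1
  have f2 := h'.1
  refine ⟨inferInstance, ?_, ?_⟩
  · unfold SCLDPC.mG
    refine (ae_map_iff hφ.aemeasurable (measurableSet_singleton (⊥ : EReal)).compl).2 ?_
    filter_upwards [hae] with p hp
    exact hb p.1 p.2 hp.1 hp.2
  · unfold SCLDPC.mG
    rw [integrable_map_measure measurable_entFn.aestronglyMeasurable hφ.aemeasurable]
    refine hintg.mono' (measurable_entFn.comp hφ).aestronglyMeasurable ?_
    filter_upwards [hae] with p hp
    rw [Function.comp_apply, Real.norm_of_nonneg (entFn_nonneg _)]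
    exact hle p.1 p.2 hp.1 hp.2

lemma ck_le (a b : EReal) (ha : a ≠ ⊥) (hb : b ≠ ⊥) : entFn (ck (a, b)) ≤ entFn a + entFn b := by
  have := duality_pt ha hb
  have := entFn_nonneg (vk (a, b))
  linarith

lemma vk_le (a b : EReal) (ha : a ≠ ⊥) (hb : b ≠ ⊥) : entFn (vk (a, b)) ≤ entFn a + entFn b := by
  have := duality_pt ha hb
  have := entFn_nonneg (ck (a, b))
  linarith

lemma Good.ck {μ ν : Measure EReal} (h : Good μ) (h' : Good ν) : Good (SCLDPC.mG ck μ ν) :=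
  h.mG measurable_ck (fun _ _ => ck_ne_bot) ck_le h'

lemma Good.vk {μ ν : Measure EReal} (h : Good μ) (h' : Good ν) : Good (SCLDPC.mG vk μ ν) :=
  (h.mG measurable_vk (fun _ _ => vk_ne_bot) vk_le h' : Good (SCLDPC.mG SCLDPC.vk μ ν))

/-- Duality rule for measures. -/
lemma duality_meas {μ ν : Measure EReal} (h : Good μ) (h' : Good ν) :
    ∫ a, entFn a ∂(mG vk μ ν) + ∫ a, entFn a ∂(mG ck μ ν)
      = (∫ a, entFn a ∂μ) * ν.real Set.univ + (∫ a, entFn a ∂ν) * μ.real Set.univ := by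
  have hae := ae_prod_ne h h'
  have gc := (h.ck h').2.2
  have gv := (h.vk h').2.2
  have f1 := h.1
  have f2 := h'.1
  unfold mG at gc gv ⊢
  rw [integrable_map_measure measurable_entFn.aestronglyMeasurable
    measurable_ck.aemeasurable] at gc
  rw [integrable_map_measure measurable_entFn.aestronglyMeasurable
    measurable_vk.aemeasurable] at gv
  rw [integral_map measurable_ck.aemeasurable measurable_entFn.aestronglyMeasurable,
    integral_map measurable_vk.aemeasurable measurable_entFn.aestronglyMeasurable]
  have e := integral_add gv gc
  simp only [Function.comp_apply] at e
  rw [← e]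
  have e2 : ∫ p, (entFn (SCLDPC.vk p) + entFn (SCLDPC.ck p)) ∂(μ.prod ν)
      = ∫ p : EReal × EReal, (entFn p.1 + entFn p.2) ∂(μ.prod ν) := by
    apply integral_congr_ae
    filter_upwards [hae] with p hp
    exact duality_pt hp.1 hp.2
  rw [e2, integral_add (h.2.2.comp_fst ν) (h'.2.2.comp_snd μ)]
  rw [integral_fun_fst, integral_fun_snd]
  simp only [smul_eq_mul]
  ring

lemma Good.of_symm {μ : Measure EReal} [IsFiniteMeasure μ] (h : IsSymmMeasure μ) : Good μ := by
  have hbot : μ {⊥} = 0 := by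
    have h1 := h {⊥} (measurableSet_singleton _)
    have e : (fun a : EReal => -a) ⁻¹' {⊥} = {⊤} := by
      ext a; simp
    rw [e, Measure.restrict_singleton, Measure.restrict_singleton] at h1
    simp only [lintegral_smul_measure, lintegral_dirac] at h1
    simp [wt] at h1
    by_contra hne
    exact hne h1
  have hae : ∀ᵐ a ∂μ, a ≠ ⊥ := by
    rw [ae_iff]; simpa using hbot
  refine ⟨inferInstance, hae, ?_⟩
  have hwt1 : ∀ a : EReal, 0 ≤ a → wt a ≤ 1 := by
    intro a ha
    induction a with
    | bot => simp at ha
    | top => simp [wt]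
    | coe a =>
      have ha' : (0 : ℝ) ≤ a := by exact_mod_cast ha
      simp only [wt, EReal.coe_ne_bot, EReal.coe_ne_top, if_false, EReal.toReal_coe]
      rw [← ENNReal.ofReal_one]
      apply ENNReal.ofReal_le_ofReal
      rw [← Real.exp_zero]
      apply Real.exp_le_exp.2
      linarith
  have hpos : ∫⁻ a in Set.Ici 0, wt a ∂μ < ⊤ := by
    calc ∫⁻ a in Set.Ici 0, wt a ∂μ ≤ ∫⁻ a in Set.Ici 0, 1 ∂μ :=
          setLIntegral_mono measurable_const (fun a ha => hwt1 a ha)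
      _ = μ (Set.Ici 0) := by simp
      _ < ⊤ := measure_lt_top _ _
  have hneg : ∫⁻ a in (Set.Ici 0)ᶜ, wt a ∂μ < ⊤ := by
    have h1 := h (Set.Ici 0) measurableSet_Ici
    refine lt_of_le_of_lt ?_ (h1.trans_lt hpos)
    apply lintegral_mono_set
    intro a ha
    simp only [Set.mem_compl_iff, Set.mem_Ici, not_le] at ha
    simp only [Set.mem_preimage, Set.mem_Ici]
    exact EReal.neg_nonneg.2 ha.le
  have htot : ∫⁻ a, wt a ∂μ < ⊤ := by
    rw [← lintegral_add_compl wt (measurableSet_Ici (a := (0 : EReal)))]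
    exact ENNReal.add_lt_top.2 ⟨hpos, hneg⟩
  refine ⟨measurable_entFn.aestronglyMeasurable, ?_⟩
  rw [hasFiniteIntegral_iff_ofReal (Eventually.of_forall entFn_nonneg)]
  have hle : ∀ a : EReal, ENNReal.ofReal (entFn a) ≤ ENNReal.ofReal (2 / Real.log 2) * wt a := by
    intro a
    have l2 : 0 < Real.log 2 := Real.log_pos (by norm_num)
    induction a with
    | bot => simp [entFn]
    | top => simp [entFn]
    | coe a =>
      simp only [wt, EReal.coe_ne_bot, EReal.coe_ne_top, if_false, EReal.toReal_coe]
      rw [← ENNReal.ofReal_mul (by positivity)]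
      apply ENNReal.ofReal_le_ofReal
      rw [entFn_coe, Real.logb]
      have p := Real.exp_pos (-a / 2)
      have e : Real.exp (-a) = Real.exp (-a / 2) * Real.exp (-a / 2) := by
        rw [← Real.exp_add]; congr 1; ring
      rw [div_mul_eq_mul_div]
      apply div_le_div_of_nonneg_right _ l2.le
      calc Real.log (1 + Real.exp (-a)) ≤ Real.log ((1 + Real.exp (-a / 2)) ^ 2) := by
            apply Real.log_le_log (by positivity)
            rw [e]; nlinarith
        _ = 2 * Real.log (1 + Real.exp (-a / 2)) := by rw [Real.log_pow]; norm_num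
        _ ≤ 2 * Real.exp (-a / 2) := by
            have := Real.log_le_sub_one_of_pos (show 0 < 1 + Real.exp (-a / 2) by positivity)
            linarith
  refine lt_of_le_of_lt (lintegral_mono hle) ?_
  rw [lintegral_const_mul _ measurable_wt]
  exact ENNReal.mul_lt_top ENNReal.ofReal_lt_top htot

/-! ### The good subspace of signed measures -/

/-- Differences of good measures. -/
def GS : Submodule ℝ SM where
  carrier := {x | ∃ (μ ν : Measure EReal) (_ : IsFiniteMeasure μ) (_ : IsFiniteMeasure ν),
    Good μ ∧ Good ν ∧ x = μ.toSignedMeasure - ν.toSignedMeasure}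
  zero_mem' := by
    have h0 : Good (0 : Measure EReal) := ⟨inferInstance, by simp, integrable_zero_measure⟩
    exact ⟨0, 0, inferInstance, inferInstance, h0, h0, by simp⟩
  add_mem' := by
    rintro x y ⟨μ, ν, i1, i2, h1, h2, rfl⟩ ⟨μ', ν', i1', i2', h1', h2', rfl⟩
    refine ⟨μ + μ', ν + ν', inferInstance, inferInstance, h1.add h1', h2.add h2', ?_⟩
    rw [Measure.toSignedMeasure_add, Measure.toSignedMeasure_add]
    abel
  smul_mem' := by
    rintro c x ⟨μ, ν, i1, i2, h1, h2, rfl⟩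
    rcases le_total 0 c with hc | hc
    · lift c to NNReal using hc
      refine ⟨c • μ, c • ν, inferInstance, inferInstance, h1.smul c, h2.smul c, ?_⟩
      rw [Measure.toSignedMeasure_smul, Measure.toSignedMeasure_smul, NNReal.smul_def,
        NNReal.smul_def]
      module
    · obtain ⟨d, rfl⟩ : ∃ d : ℝ, c = -d := ⟨-c, by simp⟩
      have hd : 0 ≤ d := by linarith
      lift d to NNReal using hd
      refine ⟨d • ν, d • μ, inferInstance, inferInstance, h2.smul d, h1.smul d, ?_⟩
      rw [Measure.toSignedMeasure_smul, Measure.toSignedMeasure_smul, NNReal.smul_def,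
        NNReal.smul_def]
      module

lemma H_eq {μ ν : Measure EReal} [IsFiniteMeasure μ] [IsFiniteMeasure ν]
    (h : Good μ) (h' : Good ν) :
    H (μ.toSignedMeasure - ν.toSignedMeasure) = ∫ a, entFn a ∂μ - ∫ a, entFn a ∂ν := by
  set x : SM := μ.toSignedMeasure - ν.toSignedMeasure with hx
  have e := measure_eq_of_sub_eq hx
  have l1 : jp x ≤ μ := by
    unfold jp
    rw [hx, Measure.toJordanDecomposition_toSignedMeasure_sub]
    exact Measure.sub_le
  have l2 : jn x ≤ ν := by
    unfold jn
    rw [hx, Measure.toJordanDecomposition_toSignedMeasure_sub]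
    exact Measure.sub_le
  have i1 := h.2.2.mono_measure l1
  have i2 := h'.2.2.mono_measure l2
  have e2 : ∫ a, entFn a ∂(jp x + ν) = ∫ a, entFn a ∂(μ + jn x) := by rw [e]
  rw [integral_add_measure i1 h'.2.2, integral_add_measure h.2.2 i2] at e2
  unfold H sInt
  linarith

lemma GS_of_good {μ : Measure EReal} [IsFiniteMeasure μ] (h : Good μ) :
    μ.toSignedMeasure ∈ GS := by
  have h0 : Good (0 : Measure EReal) := ⟨inferInstance, by simp, integrable_zero_measure⟩
  exact ⟨μ, 0, inferInstance, inferInstance, h, h0, by simp⟩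

/-- The entropy functional extends linearly from the good subspace. -/
lemma exists_lin : ∃ g : SM →ₗ[ℝ] ℝ, ∀ x ∈ GS, H x = g x := by
  let Hl : GS →ₗ[ℝ] ℝ :=
    { toFun := fun x => H x
      map_add' := by
        rintro ⟨x, μ, ν, i1, i2, h1, h2, rfl⟩ ⟨y, μ', ν', i1', i2', h1', h2', rfl⟩
        have e : (μ.toSignedMeasure - ν.toSignedMeasure)
            + (μ'.toSignedMeasure - ν'.toSignedMeasure)
            = (μ + μ').toSignedMeasure - (ν + ν').toSignedMeasure := by
          rw [Measure.toSignedMeasure_add, Measure.toSignedMeasure_add]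
          abel
        show H ((μ.toSignedMeasure - ν.toSignedMeasure)
            + (μ'.toSignedMeasure - ν'.toSignedMeasure)) = H _ + H _
        rw [e, H_eq (h1.add h1') (h2.add h2'), H_eq h1 h2, H_eq h1' h2',
          integral_add_measure h1.2.2 h1'.2.2, integral_add_measure h2.2.2 h2'.2.2]
        ring
      map_smul' := by
        rintro c ⟨x, μ, ν, i1, i2, h1, h2, rfl⟩
        show H (c • (μ.toSignedMeasure - ν.toSignedMeasure)) = c * H _
        rcases le_total 0 c with hc | hc
        · lift c to NNReal using hc
          have e : (c : ℝ) • (μ.toSignedMeasure - ν.toSignedMeasure)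
              = (c • μ).toSignedMeasure - (c • ν).toSignedMeasure := by
            rw [Measure.toSignedMeasure_smul, Measure.toSignedMeasure_smul, NNReal.smul_def,
              NNReal.smul_def]
            module
          rw [e, H_eq (h1.smul c) (h2.smul c), H_eq h1 h2, integral_smul_nnreal_measure,
            integral_smul_nnreal_measure, NNReal.smul_def, NNReal.smul_def, smul_eq_mul,
            smul_eq_mul]
          ring
        · obtain ⟨d, rfl⟩ : ∃ d : ℝ, c = -d := ⟨-c, by simp⟩
          have hd : 0 ≤ d := by linarith
          lift d to NNReal using hd
          have e : (-(d : ℝ)) • (μ.toSignedMeasure - ν.toSignedMeasure)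
              = (d • ν).toSignedMeasure - (d • μ).toSignedMeasure := by
            rw [Measure.toSignedMeasure_smul, Measure.toSignedMeasure_smul, NNReal.smul_def,
              NNReal.smul_def]
            module
          rw [e, H_eq (h2.smul d) (h1.smul d), H_eq h1 h2, integral_smul_nnreal_measure,
            integral_smul_nnreal_measure, NNReal.smul_def, NNReal.smul_def, smul_eq_mul,
            smul_eq_mul]
          ring }
  obtain ⟨g, hg⟩ := LinearMap.exists_extend Hl
  refine ⟨g, fun x hx => ?_⟩
  have := LinearMap.congr_fun hg ⟨x, hx⟩
  exact this.symm

/-- The bilinear check-node operation. -/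
def Bc : SM →ₗ[ℝ] SM →ₗ[ℝ] SM := bG ck measurable_ck

/-- The bilinear variable-node operation. -/
def Bv : SM →ₗ[ℝ] SM →ₗ[ℝ] SM := bG vk measurable_vk

lemma sCheck_Bc (x y : SM) : sCheck x y = Bc x y := rfl

lemma sConv_Bv (x y : SM) : sConv x y = Bv x y := rfl

lemma Bc_comm (x y : SM) : Bc x y = Bc y x := bG_comm measurable_ck ck_comm x y

lemma Bv_comm (x y : SM) : Bv x y = Bv y x := bG_comm measurable_vk vk_comm x y

lemma Bc_assoc (x y z : SM) : Bc (Bc x y) z = Bc x (Bc y z) := bG_assoc measurable_ck ck_assoc x y z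

lemma Bv_assoc (x y z : SM) : Bv (Bv x y) z = Bv x (Bv y z) := bG_assoc measurable_vk vk_assoc x y z

lemma Bc_mem {x y : SM} (hx : x ∈ GS) (hy : y ∈ GS) : Bc x y ∈ GS := by
  obtain ⟨μ, ν, i1, i2, h1, h2, rfl⟩ := hx
  obtain ⟨μ', ν', i1', i2', h1', h2', rfl⟩ := hy
  unfold Bc
  simp only [map_sub, LinearMap.sub_apply, bG_meas]
  exact GS.sub_mem (GS.sub_mem (GS_of_good (h1.ck h1')) (GS_of_good (h2.ck h1')))
    (GS.sub_mem (GS_of_good (h1.ck h2')) (GS_of_good (h2.ck h2')))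

lemma Bv_mem {x y : SM} (hx : x ∈ GS) (hy : y ∈ GS) : Bv x y ∈ GS := by
  obtain ⟨μ, ν, i1, i2, h1, h2, rfl⟩ := hx
  obtain ⟨μ', ν', i1', i2', h1', h2', rfl⟩ := hy
  unfold Bv
  simp only [map_sub, LinearMap.sub_apply, bG_meas]
  exact GS.sub_mem (GS.sub_mem (GS_of_good (h1.vk h1')) (GS_of_good (h2.vk h1')))
    (GS.sub_mem (GS_of_good (h1.vk h2')) (GS_of_good (h2.vk h2')))

lemma good_dirac (a : EReal) (ha : a ≠ ⊥) : Good (Measure.dirac a) := by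
  refine ⟨inferInstance, ?_, ?_⟩
  · rw [ae_dirac_eq]; exact ha
  · exact integrable_dirac (by simp [enorm_lt_top])

lemma d0_mem : d0 ∈ GS := GS_of_good (good_dirac 0 (by simp))

lemma dTop_mem : dTop ∈ GS := GS_of_good (good_dirac ⊤ (by simp))

lemma checkPow_mem {x : SM} (hx : x ∈ GS) (n : ℕ) : checkPow x n ∈ GS := by
  induction n with
  | zero => exact dTop_mem
  | succ n ih => exact Bc_mem ih hx

lemma convPow_mem {x : SM} (hx : x ∈ GS) (n : ℕ) : convPow x n ∈ GS := by
  induction n with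
  | zero => exact d0_mem
  | succ n ih => exact Bv_mem ih hx

lemma polyCheck_mem {x : SM} (hx : x ∈ GS) (p : Polynomial ℝ) : polyCheck p x ∈ GS :=
  GS.sum_mem fun n _ => GS.smul_mem _ (checkPow_mem hx n)

lemma polyConv_mem {x : SM} (hx : x ∈ GS) (p : Polynomial ℝ) : polyConv p x ∈ GS :=
  GS.sum_mem fun n _ => GS.smul_mem _ (convPow_mem hx n)

lemma memX_mem {x : SM} (hx : MemX x) : x ∈ GS :=
  ⟨jp x, jn x, inferInstance, inferInstance, Good.of_symm hx.2.1, Good.of_symm hx.2.2, jordan_eq x⟩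

lemma memX_univ {x : SM} (hx : MemX x) : x Set.univ = 1 := by
  obtain ⟨⟨μ, hμ, rfl⟩, -⟩ := hx
  rw [Measure.toSignedMeasure_apply_measurable MeasurableSet.univ]
  simp

lemma mG_univ {φ : EReal × EReal → EReal} (hφ : Measurable φ) (μ ν : Measure EReal)
    [IsFiniteMeasure μ] [IsFiniteMeasure ν] :
    (mG φ μ ν).real Set.univ = μ.real Set.univ * ν.real Set.univ := by
  unfold mG
  rw [map_measureReal_apply hφ MeasurableSet.univ, Set.preimage_univ, ← Set.univ_prod_univ,
    measureReal_prod_prod]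

lemma Bc_univ (x y : SM) : Bc x y Set.univ = x Set.univ * y Set.univ := by
  rw [jordan_eq x, jordan_eq y]
  unfold Bc
  simp only [map_sub, LinearMap.sub_apply, bG_meas, _root_.sub_apply,
    Measure.toSignedMeasure_apply_measurable MeasurableSet.univ, mG_univ measurable_ck]
  ring

/-- Duality rule for signed measures. -/
lemma duality {x z : SM} (hx : x ∈ GS) (hz : z ∈ GS) :
    H (Bv x z) + H (Bc x z) = H x * z Set.univ + H z * x Set.univ := by
  obtain ⟨g, hg⟩ := exists_lin
  rw [hg _ (Bv_mem hx hz), hg _ (Bc_mem hx hz), hg _ hx, hg _ hz]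
  have key : ∀ (μ ν : Measure EReal) [IsFiniteMeasure μ] [IsFiniteMeasure ν], Good μ → Good ν →
      g (mG vk μ ν).toSignedMeasure + g (mG ck μ ν).toSignedMeasure
        = g μ.toSignedMeasure * ν.real Set.univ + g ν.toSignedMeasure * μ.real Set.univ := by
    intro μ ν _ _ h h'
    have h0 : Good (0 : Measure EReal) := ⟨inferInstance, by simp, integrable_zero_measure⟩
    have gm : ∀ (τ : Measure EReal) [IsFiniteMeasure τ], Good τ →
        g τ.toSignedMeasure = ∫ a, entFn a ∂τ := by
      intro τ _ hτ
      rw [← hg _ (GS_of_good hτ)]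
      have := H_eq hτ h0
      simpa using this
    rw [gm _ (h.vk h'), gm _ (h.ck h'), gm _ h, gm _ h', duality_meas h h']
  obtain ⟨μ, ν, i1, i2, h1, h2, rfl⟩ := hx
  obtain ⟨μ', ν', i1', i2', h1', h2', rfl⟩ := hz
  unfold Bv Bc
  simp only [map_sub, LinearMap.sub_apply, bG_meas, _root_.sub_apply,
    Measure.toSignedMeasure_apply_measurable MeasurableSet.univ]
  have k1 := key μ μ' h1 h1'
  have k2 := key ν μ' h2 h1'
  have k3 := key ν ν' h2 h2'
  have k4 := key μ ν' h1 h2'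
  linear_combination k1 - k2 + k3 - k4

/-! ### Polynomial curves of signed measures -/

/-- Polynomial curves in the space of signed measures. -/
def PCv : Submodule ℝ (ℝ → SM) :=
  Submodule.span ℝ {f | ∃ (k : ℕ) (s : SM), f = fun δ => δ ^ k • s}

lemma PCv_const (s : SM) : (fun _ : ℝ => s) ∈ PCv :=
  Submodule.subset_span ⟨0, s, by funext δ; simp⟩

lemma PCv_mul {r : ℝ → SM} (hr : r ∈ PCv) : (fun δ : ℝ => δ • r δ) ∈ PCv := by
  induction hr using Submodule.span_induction with
  | mem x h =>
    obtain ⟨k, s, rfl⟩ := h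
    exact Submodule.subset_span ⟨k + 1, s, by funext δ; rw [smul_smul, pow_succ']⟩
  | zero =>
    convert PCv.zero_mem using 1
    funext δ
    simp
  | add x y _ _ hx hy =>
    convert PCv.add_mem hx hy using 1
    funext δ
    simp
  | smul a x _ hx =>
    convert PCv.smul_mem a hx using 1
    funext δ
    simp only [Pi.smul_apply]
    module

lemma PCv_bil (B : SM →ₗ[ℝ] SM →ₗ[ℝ] SM) {r r' : ℝ → SM} (hr : r ∈ PCv) (hr' : r' ∈ PCv) :
    (fun δ : ℝ => B (r δ) (r' δ)) ∈ PCv := by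
  induction hr using Submodule.span_induction with
  | mem x h =>
    obtain ⟨k, s, rfl⟩ := h
    induction hr' using Submodule.span_induction with
    | mem x' h' =>
      obtain ⟨k', s', rfl⟩ := h'
      refine Submodule.subset_span ⟨k + k', B s s', ?_⟩
      funext δ
      simp only [map_smul, LinearMap.smul_apply, smul_smul, pow_add]
      rw [mul_comm]
    | zero =>
      convert PCv.zero_mem using 1
      funext δ
      simp
    | add x y _ _ hx hy =>
      convert PCv.add_mem hx hy using 1
      funext δ
      simp
    | smul a x _ hx =>
      convert PCv.smul_mem a hx using 1
      funext δ
      simp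
  | zero =>
    convert PCv.zero_mem using 1
    funext δ
    simp
  | add x y _ _ hx hy =>
    convert PCv.add_mem hx hy using 1
    funext δ
    simp
  | smul a x _ hx =>
    convert PCv.smul_mem a hx using 1
    funext δ
    simp

lemma PCv_cont (g : SM →ₗ[ℝ] ℝ) {r : ℝ → SM} (hr : r ∈ PCv) :
    Continuous fun δ => g (r δ) := by
  induction hr using Submodule.span_induction with
  | mem x h =>
    obtain ⟨k, s, rfl⟩ := h
    simp only [map_smul, smul_eq_mul]
    fun_prop
  | zero =>
    simp only [Pi.zero_apply, map_zero]
    exact continuous_const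
  | add x y _ _ hx hy =>
    simp only [Pi.add_apply, map_add]
    exact hx.add hy
  | smul a x _ hx =>
    simp only [Pi.smul_apply, map_smul]
    exact hx.const_smul a

/-- The curve `γ` has value `a` and derivative `b` at zero. -/
def DC (γ : ℝ → SM) (a b : SM) : Prop :=
  ∃ r ∈ PCv, ∀ δ : ℝ, γ δ = a + δ • b + δ ^ 2 • r δ

lemma DC_const (a : SM) : DC (fun _ => a) a 0 :=
  ⟨0, PCv.zero_mem, fun δ => by simp⟩

lemma DC_line (a b : SM) : DC (fun δ => a + δ • b) a b :=
  ⟨0, PCv.zero_mem, fun δ => by simp⟩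

lemma DC_smul (c : ℝ) {γ : ℝ → SM} {a b : SM} (h : DC γ a b) :
    DC (fun δ => c • γ δ) (c • a) (c • b) := by
  obtain ⟨r, hr, e⟩ := h
  refine ⟨c • r, PCv.smul_mem c hr, fun δ => ?_⟩
  beta_reduce
  rw [e, Pi.smul_apply]
  module

lemma DC_add {γ γ' : ℝ → SM} {a b a' b' : SM} (h : DC γ a b) (h' : DC γ' a' b') :
    DC (fun δ => γ δ + γ' δ) (a + a') (b + b') := by
  obtain ⟨r, hr, e⟩ := h
  obtain ⟨r', hr', e'⟩ := h'
  refine ⟨r + r', PCv.add_mem hr hr', fun δ => ?_⟩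
  beta_reduce
  rw [e, e', Pi.add_apply]
  module

lemma DC_sum (s : Finset ℕ) {γ : ℕ → ℝ → SM} {a b : ℕ → SM} (h : ∀ n, DC (γ n) (a n) (b n)) :
    DC (fun δ => ∑ n ∈ s, γ n δ) (∑ n ∈ s, a n) (∑ n ∈ s, b n) := by
  induction s using Finset.induction_on with
  | empty => simpa using DC_const 0
  | insert n s hn ih =>
    simp only [Finset.sum_insert hn]
    exact DC_add (h n) ih

lemma DC_bil (B : SM →ₗ[ℝ] SM →ₗ[ℝ] SM) {γ γ' : ℝ → SM} {a b a' b' : SM} (h : DC γ a b)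
    (h' : DC γ' a' b') : DC (fun δ => B (γ δ) (γ' δ)) (B a a') (B a b' + B b a') := by
  obtain ⟨r, hr, e⟩ := h
  obtain ⟨r', hr', e'⟩ := h'
  have m1 := PCv_const (B b b')
  have m2 := PCv_bil B (PCv_const a) hr'
  have m3 := PCv_bil B hr (PCv_const a')
  have m4 := PCv_mul (PCv_bil B (PCv_const b) hr')
  have m5 := PCv_mul (PCv_bil B hr (PCv_const b'))
  have m6 := PCv_mul (PCv_mul (PCv_bil B hr hr'))
  refine ⟨_, PCv.add_mem m1 (PCv.add_mem m2 (PCv.add_mem m3 (PCv.add_mem m4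
    (PCv.add_mem m5 m6)))), fun δ => ?_⟩
  beta_reduce
  rw [e, e']
  simp only [map_add, map_smul, LinearMap.add_apply, LinearMap.smul_apply, Pi.add_apply]
  module

lemma DC_deriv (g : SM →ₗ[ℝ] ℝ) {γ : ℝ → SM} {a b : SM} (h : DC γ a b) :
    HasDerivAt (fun δ => g (γ δ)) (g b) 0 := by
  obtain ⟨r, hr, e⟩ := h
  have hc := PCv_cont g hr
  have e2 : (fun δ => g (γ δ)) = fun δ => g a + δ * g b + δ * (δ * g (r δ)) := by
    funext δ
    rw [e]
    simp only [map_add, map_smul, smul_eq_mul]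
    ring
  rw [e2, hasDerivAt_iff_tendsto_slope_zero]
  have h1 : Tendsto (fun t : ℝ => g b + t * g (r t)) (𝓝[≠] 0) (𝓝 (g b + 0 * g (r 0))) :=
    ((continuous_const.add (continuous_id.mul hc)).tendsto 0).mono_left nhdsWithin_le_nhds
  rw [zero_mul, add_zero] at h1
  refine h1.congr' ?_
  filter_upwards [self_mem_nhdsWithin] with t ht
  have ht' : t ≠ 0 := ht
  simp only [zero_add, smul_eq_mul]
  field_simp
  ring

lemma DC_pow (B : SM →ₗ[ℝ] SM →ₗ[ℝ] SM) (hcm : ∀ x y, B x y = B y x)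
    (has : ∀ x y z, B (B x y) z = B x (B y z)) (e : SM) (P : SM → ℕ → SM)
    (hP0 : ∀ x, P x 0 = e) (hPs : ∀ x n, P x (n + 1) = B (P x n) x)
    {γ : ℝ → SM} {a b : SM} (h : DC γ a b) (n : ℕ) :
    DC (fun δ => P (γ δ) n) (P a n) ((n : ℝ) • B (P a (n - 1)) b) := by
  induction n with
  | zero =>
    simp only [hP0, Nat.cast_zero, zero_smul]
    exact DC_const e
  | succ n ih =>
    have h2 := DC_bil B ih h
    simp only [hPs]
    convert h2 using 1
    rw [Nat.add_sub_cancel, map_smul, LinearMap.smul_apply]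
    rcases n with _ | m
    · simp
    · rw [Nat.add_sub_cancel, has, hcm b a, ← has, ← hPs]
      push_cast
      module

/-- Generic polynomial in a product. -/
def gp (P : SM → ℕ → SM) (p : Polynomial ℝ) (x : SM) : SM :=
  ∑ n ∈ Finset.range (p.natDegree + 1), p.coeff n • P x n

lemma gp_eq (P : SM → ℕ → SM) (p : Polynomial ℝ) (x : SM) (N : ℕ) (hN : p.natDegree < N) :
    gp P p x = ∑ n ∈ Finset.range N, p.coeff n • P x n := by
  unfold gp
  apply Finset.sum_subset
  · intro n hn
    simp only [Finset.mem_range] at hn ⊢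
    omega
  · intro n _ hn
    simp only [Finset.mem_range, not_lt] at hn
    rw [Polynomial.coeff_eq_zero_of_natDegree_lt (by omega), zero_smul]

lemma gp_C_mul (P : SM → ℕ → SM) (c : ℝ) (p : Polynomial ℝ) (x : SM) :
    gp P (Polynomial.C c * p) x = c • gp P p x := by
  rw [gp_eq P (Polynomial.C c * p) x (p.natDegree + 1)
    (Nat.lt_succ_of_le (Polynomial.natDegree_C_mul_le c p)), gp, Finset.smul_sum]
  simp only [Polynomial.coeff_C_mul, smul_smul]

lemma DC_gp (B : SM →ₗ[ℝ] SM →ₗ[ℝ] SM) (hcm : ∀ x y, B x y = B y x)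
    (has : ∀ x y z, B (B x y) z = B x (B y z)) (e : SM) (P : SM → ℕ → SM)
    (hP0 : ∀ x, P x 0 = e) (hPs : ∀ x n, P x (n + 1) = B (P x n) x)
    {γ : ℝ → SM} {a b : SM} (h : DC γ a b) (p : Polynomial ℝ) :
    DC (fun δ => gp P p (γ δ)) (gp P p a) (B (gp P (derivative p) a) b) := by
  have h1 := DC_sum (Finset.range (p.natDegree + 2))
    (fun n => DC_smul (p.coeff n) (DC_pow B hcm has e P hP0 hPs h n))
  have e1 : ∀ x, gp P p x = ∑ n ∈ Finset.range (p.natDegree + 2), p.coeff n • P x n :=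
    fun x => gp_eq P p x _ (by omega)
  simp only [e1]
  convert h1 using 1
  rw [Finset.sum_range_succ', gp_eq P (derivative p) a (p.natDegree + 1)
    (Nat.lt_succ_of_le ((Polynomial.natDegree_derivative_le p).trans (Nat.sub_le _ _)))]
  simp only [map_sum, LinearMap.sum_apply, map_smul, LinearMap.smul_apply, Nat.cast_zero,
    zero_smul, smul_zero, add_zero, Nat.add_sub_cancel, Polynomial.coeff_derivative, smul_smul]
  push_cast
  rfl

lemma polyCheck_gp (p : Polynomial ℝ) (x : SM) : polyCheck p x = gp checkPow p x := rfl

lemma polyConv_gp (p : Polynomial ℝ) (x : SM) : polyConv p x = gp convPow p x := rfl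

lemma DC_check {γ : ℝ → SM} {a b : SM} (h : DC γ a b) (p : Polynomial ℝ) :
    DC (fun δ => polyCheck p (γ δ)) (polyCheck p a) (Bc (polyCheck (derivative p) a) b) :=
  DC_gp Bc Bc_comm Bc_assoc dTop checkPow (fun _ => rfl) (fun _ _ => rfl) h p

lemma DC_conv {γ : ℝ → SM} {a b : SM} (h : DC γ a b) (p : Polynomial ℝ) :
    DC (fun δ => polyConv p (γ δ)) (polyConv p a) (Bv (polyConv (derivative p) a) b) :=
  DC_gp Bv Bv_comm Bv_assoc d0 convPow (fun _ => rfl) (fun _ _ => rfl) h p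

/-- For all `x, c ∈ X` and `y ∈ X_d`, the directional derivative of
the potential functional at `x` in direction `y` exists and equals
`L'(1) · H([x - c ⊛ λ^⊛(ρ^⊠(x))] ⊛ [ρ'^⊠(x) ⊠ y])`. -/
theorem potential_directional_derivative
    (lam rho L R : Polynomial ℝ)
    (hlam0 : lam.coeff 0 = 0) (hrho0 : rho.coeff 0 = 0)
    (hlamnn : ∀ n, 0 ≤ lam.coeff n) (hrhonn : ∀ n, 0 ≤ rho.coeff n)
    (hlam1 : lam.eval 1 = 1) (hrho1 : rho.eval 1 = 1)
    (hL0 : L.eval 0 = 0) (hL1 : L.eval 1 = 1)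
    (hR0 : R.eval 0 = 0) (hR1 : R.eval 1 = 1)
    (hLd : derivative L = Polynomial.C ((derivative L).eval 1) * lam)
    (hRd : derivative R = Polynomial.C ((derivative R).eval 1) * rho)
    (x c y : SM) (hx : MemX x) (hc : MemX c) (hy : MemXd y) :
    Tendsto
      (fun δ : ℝ => (potU rho L R (x + δ • y) c - potU rho L R x c) / δ)
      (𝓝[≠] (0 : ℝ))
      (𝓝 ((derivative L).eval 1 *
        H (sConv (x - sConv c (polyConv lam (polyCheck rho x)))
            (sCheck (polyCheck (derivative rho) x) y)))) := by
  have hxS := memX_mem hx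
  have hcS := memX_mem hc
  have hyS : y ∈ GS := by
    obtain ⟨x1, x2, h1, h2, rfl⟩ := hy
    exact GS.sub_mem (memX_mem h1) (memX_mem h2)
  have hy0 : y Set.univ = 0 := by
    obtain ⟨x1, x2, h1, h2, rfl⟩ := hy
    rw [_root_.sub_apply, memX_univ h1, memX_univ h2, sub_self]
  have hR : (derivative R).eval 1 ≠ 0 := by
    intro h0
    rw [h0, Polynomial.C_0, zero_mul] at hRd
    have hC := Polynomial.eq_C_of_derivative_eq_zero hRd
    rw [hC] at hR0 hR1
    simp only [Polynomial.eval_C] at hR0 hR1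
    rw [hR0] at hR1
    exact zero_ne_one hR1
  obtain ⟨g, hg⟩ := exists_lin
  set L1 := (derivative L).eval 1 with hL1d
  set R1 := (derivative R).eval 1 with hR1d
  set z := Bc (polyCheck (derivative rho) x) y with hz
  have hzS : z ∈ GS := Bc_mem (polyCheck_mem hxS _) hyS
  have hz0 : z Set.univ = 0 := by rw [hz, Bc_univ, hy0, mul_zero]
  have hdual : g (Bv x z) + g (Bc x z) = g z := by
    have h := duality hxS hzS
    rw [hz0, memX_univ hx, hg _ (Bv_mem hxS hzS), hg _ (Bc_mem hxS hzS), hg _ hzS] at h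
    linarith
  have hlS : ∀ δ : ℝ, x + δ • y ∈ GS := fun δ => GS.add_mem hxS (GS.smul_mem _ hyS)
  have hU : ∀ w ∈ GS, potU rho L R w c = L1 / R1 * g (polyCheck R w) + L1 * g (polyCheck rho w)
      - L1 * g (Bc w (polyCheck rho w)) - g (Bv c (polyConv L (polyCheck rho w))) := by
    intro w hw
    have hr := polyCheck_mem hw rho
    unfold potU
    rw [hg _ (polyCheck_mem hw R), hg _ hr, sCheck_Bc, sConv_Bv, hg _ (Bc_mem hw hr),
      hg _ (Bv_mem hcS (polyConv_mem hr L))]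
  have D0 := DC_line x y
  have Dr := DC_check D0 rho
  rw [← hz] at Dr
  have d1 := DC_deriv g (DC_check D0 R)
  have d2 := DC_deriv g Dr
  have d3 := DC_deriv g (DC_bil Bc D0 Dr)
  have d4 := DC_deriv g (DC_bil Bv (DC_const c) (DC_conv Dr L))
  have hd := (((d1.const_mul (L1 / R1)).add (d2.const_mul L1)).sub (d3.const_mul L1)).sub d4
  rw [hasDerivAt_iff_tendsto_slope_zero] at hd
  have eR : polyCheck (derivative R) x = R1 • polyCheck rho x := by
    rw [polyCheck_gp, hRd, gp_C_mul, ← polyCheck_gp]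
  have eL : polyConv (derivative L) (polyCheck rho x)
      = L1 • polyConv lam (polyCheck rho x) := by
    rw [polyConv_gp, hLd, gp_C_mul, ← polyConv_gp]
  have hval : L1 * H (sConv (x - sConv c (polyConv lam (polyCheck rho x)))
      (sCheck (polyCheck (derivative rho) x) y))
      = L1 / R1 * g (Bc (polyCheck (derivative R) x) y) + L1 * g z
        - L1 * g (Bc x z + Bc y (polyCheck rho x))
        - g (Bv c (Bv (polyConv (derivative L) (polyCheck rho x)) z)
          + Bv 0 (polyConv L (polyCheck rho x))) := by
    have hlamS := polyConv_mem (polyCheck_mem hxS rho) lam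
    rw [eR, eL, sCheck_Bc, sConv_Bv, sConv_Bv, ← hz,
      hg _ (Bv_mem (GS.sub_mem hxS (Bv_mem hcS hlamS)) hzS), Bc_comm y]
    simp only [map_sub, map_add, map_smul, map_zero, LinearMap.sub_apply, LinearMap.smul_apply,
      LinearMap.zero_apply, smul_eq_mul, Bv_assoc]
    have e : L1 / R1 * (R1 * g (Bc (polyCheck rho x) y)) = L1 * g (Bc (polyCheck rho x) y) := by
      field_simp
    rw [e]
    linear_combination L1 * hdual
  rw [hval]
  refine hd.congr fun t => ?_
  rw [hU _ (hlS t), hU _ hxS]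
  simp only [zero_add, smul_eq_mul, zero_smul, add_zero, Pi.add_apply, Pi.sub_apply]
  ring

end SCLDPC
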